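/- For every n ≥ 1, the polynomial identity O_n(x,y,t) = Σ_{r=1}^{n} t^r · S_{n,r} · (x+y)^{n-r} holds, where O_n(x,y,t) = Σ_{T ∈ 𝒪_n} x^{impr(T)} y^{prop(T) - deg_T(1)} t^{deg_T(1)} is the sum over all labeled plane trees T with n edges whose root is labeled 1, deg_T(1) is the number of children of the root of T, and S_{n,r} is the number of increasing plane trees with n edges whose root has exactly r children. -/

import Mathlib

/-- A plane tree with labeled vertices: a root label together with an ordered
list of child subtrees.  (A plane tree is a rooted tree in which the children
of each node are linearly ordered.) -/
inductive LTree : Type where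
  | node : ℕ → List LTree → LTree

namespace LTree

/-- The label of the root. -/
def rootLabel : LTree → ℕ
  | node a _ => a

/-- The list of child subtrees of the root. -/
def children : LTree → List LTree
  | node _ cs => cs

/-- `deg_T(root)`: the number of children of the root. -/
def rootDeg (t : LTree) : ℕ := (children t).length

mutual
  /-- The list of all vertex labels of a tree. -/
  def labels : LTree → List ℕ
    | node a cs => a :: labelsList cs
  /-- The list of all vertex labels of a forest. -/
  def labelsList : List LTree → List ℕ
    | [] => []
    | c :: rest => labels c ++ labelsList rest
end

/-- `β(v)`: the smallest label occurring in the subtree `t` rooted at `v`. -/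
def minLabel (t : LTree) : ℕ := (labels t).foldr min (rootLabel t)

/-- `min { j, β(c₁), …, β(cₖ) }` for a vertex `j` and a list of subtrees `c₁, …, cₖ`. -/
def minOver (j : ℕ) (rest : List LTree) : ℕ := (rest.map minLabel).foldr min j

mutual
  /-- The list of edges of a tree, each recorded as a (parent label, child label)
  pair, in depth-first order. -/
  def edgeList : LTree → List (ℕ × ℕ)
    | node a cs => edgeListAux a cs
  def edgeListAux : ℕ → List LTree → List (ℕ × ℕ)
    | _, [] => []
    | a, c :: rest => (a, rootLabel c) :: (edgeList c ++ edgeListAux a rest)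
end

mutual
  /-- The list of improper edges of a tree: if a vertex `j` has children
  `j₁, …, jₖ` (ordered left to right), the edge `(j, jᵢ)` is improper when
  `β(jᵢ) < min { j, β(j_{i+1}), …, β(jₖ) }`. -/
  def improperEdges : LTree → List (ℕ × ℕ)
    | node a cs => improperEdgesAux a cs
  def improperEdgesAux : ℕ → List LTree → List (ℕ × ℕ)
    | _, [] => []
    | j, c :: rest =>
        (if minLabel c < minOver j rest then [(j, rootLabel c)] else [])
          ++ improperEdges c ++ improperEdgesAux j rest
end

mutual
  /-- The list of proper (i.e. non-improper) edges of a tree. -/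
  def properEdges : LTree → List (ℕ × ℕ)
    | node a cs => properEdgesAux a cs
  def properEdgesAux : ℕ → List LTree → List (ℕ × ℕ)
    | _, [] => []
    | j, c :: rest =>
        (if minLabel c < minOver j rest then [] else [(j, rootLabel c)])
          ++ properEdges c ++ properEdgesAux j rest
end

/-- `impr T`: the number of improper edges of `T`. -/
def impr (t : LTree) : ℕ := (improperEdges t).length

/-- `prop T`: the number of proper edges of `T`. -/
def propCount (t : LTree) : ℕ := (properEdges t).length

/-- The number of edges of `T`. -/
def edgeCount (t : LTree) : ℕ := (edgeList t).length

/-- `T` is a labeled plane tree with `n` edges: its `n + 1` vertices are labeled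
bijectively with `{1, 2, …, n + 1}`. -/
def IsLPT (n : ℕ) (t : LTree) : Prop := (labels t).Perm (List.range' 1 (n + 1))

/-- `T` is increasing: vertex labels increase along every path from the root. -/
inductive Increasing : LTree → Prop where
  | node (a : ℕ) (cs : List LTree) :
      (∀ c ∈ cs, a < rootLabel c) → (∀ c ∈ cs, Increasing c) → Increasing (node a cs)

end LTree

open Nat MvPolynomial

/-- `S_{n,r}`: the number of increasing plane trees with `n` edges whose root has
exactly `r` children. -/
noncomputable def Snr (n r : ℕ) : ℕ :=
  Nat.card {T : LTree // LTree.IsLPT n T ∧ LTree.Increasing T ∧ LTree.rootDeg T = r}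

namespace LTree

/-- Attach `c` as a new leftmost child of the root. -/
def graft (c : LTree) : LTree → LTree
  | node a cs => node a (c :: cs)

theorem graft_ind {p : LTree → Prop} (h0 : ∀ a, p (node a []))
    (h1 : ∀ c T, p c → p T → p (graft c T)) : ∀ T, p T
  | node a [] => h0 a
  | node a (c :: cs) => h1 c (node a cs) (graft_ind h0 h1 c) (graft_ind h0 h1 (node a cs))

theorem graft_inj {c c' T T' : LTree} (h : graft c T = graft c' T') : c = c' ∧ T = T' := by
  cases T; cases T'
  simp only [graft, node.injEq, List.cons.injEq] at h
  grind

theorem rootLabel_graft (c T : LTree) : rootLabel (graft c T) = rootLabel T := by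
  cases T; rfl

theorem rootDeg_graft (c T : LTree) : rootDeg (graft c T) = rootDeg T + 1 := by
  cases T; rfl

theorem labels_graft (c T : LTree) :
    (labels (graft c T) : Multiset ℕ) = (labels c : Multiset ℕ) + (labels T : Multiset ℕ) := by
  cases T with
  | node a cs =>
    simp only [graft, labels, labelsList, Multiset.coe_add, Multiset.coe_eq_coe]
    exact List.perm_middle.symm

theorem mem_labels_graft (c T : LTree) (z : ℕ) :
    z ∈ labels (graft c T) ↔ z ∈ labels c ∨ z ∈ labels T := by
  have := congrArg (fun s => z ∈ s) (labels_graft c T)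
  simpa using this

theorem rootLabel_mem (T : LTree) : rootLabel T ∈ labels T := by
  cases T; simp [rootLabel, labels]

theorem foldr_min_le (l : List ℕ) (d z : ℕ) : z ≤ l.foldr min d ↔ z ≤ d ∧ ∀ w ∈ l, z ≤ w := by
  induction l with
  | nil => simp
  | cons b l ih => simp only [List.foldr_cons, le_min_iff, ih, List.mem_cons, forall_eq_or_imp]; tauto

theorem le_minLabel (T : LTree) (z : ℕ) : z ≤ minLabel T ↔ ∀ w ∈ labels T, z ≤ w := by
  rw [minLabel, foldr_min_le]
  exact ⟨fun h => h.2, fun h => ⟨h _ (rootLabel_mem T), h⟩⟩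

theorem le_minOver (a : ℕ) (cs : List LTree) (z : ℕ) :
    z ≤ minOver a cs ↔ z ≤ a ∧ ∀ w ∈ labelsList cs, z ≤ w := by
  induction cs with
  | nil => simp [minOver, labelsList]
  | cons c cs ih =>
    simp only [minOver, List.map_cons, List.foldr_cons, le_min_iff, labelsList, List.mem_append] at ih ⊢
    rw [ih, le_minLabel]
    grind

theorem minOver_eq (a : ℕ) (cs : List LTree) : minOver a cs = minLabel (node a cs) := by
  refine eq_of_forall_le_iff fun z => ?_
  rw [le_minOver, le_minLabel]
  simp [labels]

theorem impr_graft (c T : LTree) : impr (graft c T) =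
    (if minLabel c < minLabel T then 1 else 0) + impr c + impr T := by
  cases T with
  | node a cs =>
    simp only [graft, impr, improperEdges, improperEdgesAux, minOver_eq, List.length_append]
    split_ifs <;> simp

theorem propCount_graft (c T : LTree) : propCount (graft c T) =
    (if minLabel c < minLabel T then 0 else 1) + propCount c + propCount T := by
  cases T with
  | node a cs =>
    simp only [graft, propCount, properEdges, properEdgesAux, minOver_eq, List.length_append]
    split_ifs <;> simp

theorem minLabel_le {T : LTree} {z : ℕ} (h : z ∈ labels T) : minLabel T ≤ z :=
  (le_minLabel T _).1 le_rfl z h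

theorem increasing_graft (c T : LTree) : Increasing (graft c T) ↔
    Increasing c ∧ Increasing T ∧ rootLabel T < rootLabel c := by
  cases T with
  | node a cs =>
    simp only [graft]
    constructor
    · rintro ⟨_, _, h1, h2⟩
      exact ⟨h2 c (by simp), ⟨_, _, fun d hd => h1 d (by simp [hd]), fun d hd => h2 d (by simp [hd])⟩,
        h1 c (by simp)⟩
    · rintro ⟨hc, ⟨_, _, h1, h2⟩, h3⟩
      refine ⟨_, _, ?_, ?_⟩
      · intro d hd
        rcases List.mem_cons.1 hd with rfl | hd
        · exact h3
        · exact h1 d hd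
      · intro d hd
        rcases List.mem_cons.1 hd with rfl | hd
        · exact hc
        · exact h2 d hd

theorem increasing_leaf (a : ℕ) : Increasing (node a []) := ⟨_, _, by simp, by simp⟩

theorem Increasing.root_le {T : LTree} : Increasing T → ∀ z ∈ labels T, rootLabel T ≤ z := by
  induction T using graft_ind with
  | h0 a => simp [labels, labelsList, rootLabel]
  | h1 c T ihc ihT =>
    intro h z hz
    rw [increasing_graft] at h
    rw [rootLabel_graft]
    rcases (mem_labels_graft c T z).1 hz with hz | hz
    · exact h.2.2.le.trans (ihc h.1 z hz)
    · exact ihT h.2.1 z hz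

theorem rootDeg_lt (T : LTree) : rootDeg T < (labels T).length := by
  induction T using graft_ind with
  | h0 a => simp [labels, labelsList, rootDeg, children]
  | h1 c T ihc ihT =>
    have := congrArg Multiset.card (labels_graft c T)
    simp only [Multiset.coe_card, Multiset.card_add] at this
    rw [rootDeg_graft]; omega

theorem rootDeg_le_propCount (T : LTree) :
    (∀ z ∈ labels T, rootLabel T ≤ z) → rootDeg T ≤ propCount T := by
  induction T using graft_ind with
  | h0 a => simp [rootDeg, children]
  | h1 c T ihc ihT =>
    intro h
    rw [rootLabel_graft] at h
    simp only [mem_labels_graft] at h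
    have h1 := ihT fun z hz => h z (Or.inr hz)
    have h2 : ¬ minLabel c < minLabel T := by
      rw [not_lt, le_minLabel]
      exact fun w hw => (minLabel_le (rootLabel_mem T)).trans (h w (Or.inl hw))
    rw [rootDeg_graft, propCount_graft, if_neg h2]; omega

/-- Trees with label set `A`. -/
def TrSet (A : Finset ℕ) : Set LTree := {T | (labels T : Multiset ℕ) = A.val}

theorem mem_labels_of {A : Finset ℕ} {T : LTree} (h : T ∈ TrSet A) (z : ℕ) :
    z ∈ labels T ↔ z ∈ A := by
  have := congrArg (fun s => z ∈ s) (show (labels T : Multiset ℕ) = A.val from h)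
  simpa using this

theorem length_of {A : Finset ℕ} {T : LTree} (h : T ∈ TrSet A) : (labels T).length = A.card :=
  congrArg Multiset.card (show (labels T : Multiset ℕ) = A.val from h)

theorem graft_mem {A B : Finset ℕ} (hB : B ⊆ A) {c T : LTree} (hc : c ∈ TrSet B)
    (hT : T ∈ TrSet (A \ B)) : graft c T ∈ TrSet A := by
  simp only [TrSet, Set.mem_ofPred_eq] at *
  rw [labels_graft, hc, hT, Finset.sdiff_val]
  exact add_tsub_cancel_of_le (Finset.val_le_iff.2 hB)

theorem exists_of_graft_mem {A : Finset ℕ} {c T : LTree} (h : graft c T ∈ TrSet A) :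
    ∃ B, B ⊆ A ∧ c ∈ TrSet B ∧ T ∈ TrSet (A \ B) := by
  simp only [TrSet, Set.mem_ofPred_eq] at *
  rw [labels_graft] at h
  have hle : (labels c : Multiset ℕ) ≤ A.val := h ▸ Multiset.le_add_right _ _
  refine ⟨⟨(labels c : Multiset ℕ), Multiset.nodup_of_le hle A.nodup⟩,
    Finset.val_le_iff.1 hle, rfl, ?_⟩
  exact eq_tsub_of_add_eq (by rw [add_comm]; exact h)

theorem TrSet_empty : TrSet ∅ = ∅ := by
  ext T
  simp only [Set.mem_empty_iff_false, iff_false]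
  intro h
  simpa using (mem_labels_of h _).1 (rootLabel_mem T)

theorem leaf_mem (a : ℕ) {A : Finset ℕ} : node a [] ∈ TrSet A ↔ A = {a} := by
  simp only [TrSet, Set.mem_ofPred_eq, labels, labelsList, Multiset.coe_singleton]
  rw [← Finset.singleton_val, Finset.val_inj, eq_comm]

theorem nonempty_of_mem {A : Finset ℕ} {T : LTree} (h : T ∈ TrSet A) : A.Nonempty :=
  ⟨_, (mem_labels_of h _).1 (rootLabel_mem T)⟩

theorem finite_TrSet (A : Finset ℕ) : (TrSet A).Finite := by
  induction A using Finset.strongInduction with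
  | H A ih =>
    have hf : (((fun a => node a []) '' (A : Set ℕ)) ∪
        ⋃ B ∈ (A.ssubsets.filter (fun B => B.Nonempty) : Finset (Finset ℕ)),
          Set.image2 graft (TrSet B) (TrSet (A \ B))).Finite := by
      refine (A.finite_toSet.image _).union ?_
      refine Set.Finite.biUnion (Finset.finite_toSet _) fun B hB => ?_
      simp only [Finset.coe_filter, Finset.mem_ssubsets, Set.mem_ofPred_eq] at hB
      exact (ih B hB.1).image2 _ (ih _ (Finset.sdiff_ssubset hB.1.1 hB.2))
    refine hf.subset ?_
    intro T hT
    induction T using graft_ind with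
    | h0 a =>
      left
      exact ⟨a, by simp [(leaf_mem a).1 hT], rfl⟩
    | h1 c T _ _ =>
      right
      obtain ⟨B, hB, hc, hT'⟩ := exists_of_graft_mem hT
      have hne : B ≠ A := by
        rintro rfl
        simpa using nonempty_of_mem hT'
      simp only [Set.mem_iUnion, Finset.mem_filter, Finset.mem_ssubsets]
      exact ⟨B, ⟨lt_of_le_of_ne hB hne, nonempty_of_mem hc⟩, Set.mem_image2_of_mem hc hT'⟩

/-- The finset of trees with label set `A`. -/
noncomputable def Tr (A : Finset ℕ) : Finset LTree := (finite_TrSet A).toFinset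

theorem mem_Tr {A : Finset ℕ} {T : LTree} : T ∈ Tr A ↔ T ∈ TrSet A := by simp [Tr]

theorem Tr_empty : Tr ∅ = ∅ := by
  ext T; simp [mem_Tr, TrSet_empty]

theorem Tr_singleton (a : ℕ) : Tr {a} = {node a []} := by
  ext T
  rw [mem_Tr, Finset.mem_singleton]
  constructor
  · intro h
    induction T using graft_ind with
    | h0 b => rw [leaf_mem] at h; simp at h; rw [h]
    | h1 c T _ _ =>
      obtain ⟨B, hB, hc, hT'⟩ := exists_of_graft_mem h
      rcases Finset.subset_singleton_iff.1 hB with rfl | rfl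
      · simpa using nonempty_of_mem hc
      · simpa using nonempty_of_mem hT'
  · rintro rfl
    rw [leaf_mem]

theorem sum_Tr {R : Type*} [AddCommMonoid R] (A : Finset ℕ) (hA : A.card ≠ 1) (f : LTree → R) :
    ∑ T ∈ Tr A, f T = ∑ B ∈ A.powerset, ∑ c ∈ Tr B, ∑ T ∈ Tr (A \ B), f (graft c T) := by
  have h1 : ∀ B ∈ A.powerset, ∑ c ∈ Tr B, ∑ T ∈ Tr (A \ B), f (graft c T)
      = ∑ p ∈ Tr B ×ˢ Tr (A \ B), f (graft p.1 p.2) := fun B _ => (Finset.sum_product' _ _ _).symm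
  rw [Finset.sum_congr rfl h1, Finset.sum_sigma']
  symm
  refine Finset.sum_bij (fun p _ => graft p.2.1 p.2.2) ?_ ?_ ?_ (fun _ _ => rfl)
  · rintro ⟨B, c, T⟩ h
    simp only [Finset.mem_sigma, Finset.mem_powerset, Finset.mem_product, mem_Tr] at h ⊢
    exact graft_mem h.1 h.2.1 h.2.2
  · rintro ⟨B, c, T⟩ h ⟨B', c', T'⟩ h' he
    simp only [Finset.mem_sigma, Finset.mem_powerset, Finset.mem_product, mem_Tr] at h h' he
    obtain ⟨rfl, rfl⟩ := graft_inj he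
    have : B = B' := by
      ext z
      rw [← mem_labels_of h.2.1, mem_labels_of h'.2.1]
    subst this
    rfl
  · intro T hT
    rw [mem_Tr] at hT
    induction T using graft_ind with
    | h0 a => rw [(leaf_mem a).1 hT] at hA; simp at hA
    | h1 c T _ _ =>
      obtain ⟨B, hB, hc, hT'⟩ := exists_of_graft_mem hT
      exact ⟨⟨B, c, T⟩, by simp [mem_Tr, hB, hc, hT'], rfl⟩

section gf
variable {R : Type*} [CommRing R]

/-- All trees. -/
noncomputable def P (x y : R) (A : Finset ℕ) : R := ∑ T ∈ Tr A, x ^ impr T * y ^ propCount T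

open Classical in
/-- Increasing trees. -/
noncomputable def J (s t : R) (A : Finset ℕ) : R :=
  ∑ T ∈ Tr A, if Increasing T then t ^ rootDeg T * s ^ (A.card - 1 - rootDeg T) else 0

/-- Trees with root `m`. -/
noncomputable def O (x y t : R) (m : ℕ) (A : Finset ℕ) : R :=
  ∑ T ∈ Tr A, if rootLabel T = m then x ^ impr T * y ^ (propCount T - rootDeg T) * t ^ rootDeg T
    else 0

theorem minLabel_eq {A : Finset ℕ} {m : ℕ} (hm : m ∈ A) (hmin : ∀ z ∈ A, m ≤ z) {T : LTree}
    (h : T ∈ TrSet A) : minLabel T = m := by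
  apply le_antisymm
  · exact minLabel_le ((mem_labels_of h m).2 hm)
  · rw [le_minLabel]
    exact fun w hw => hmin w ((mem_labels_of h w).1 hw)

theorem minLabel_lt_iff {A B : Finset ℕ} {m : ℕ} (hm : m ∈ A) (hmin : ∀ z ∈ A, m ≤ z)
    (hB : B ⊆ A) {c T : LTree} (hc : c ∈ TrSet B) (hT : T ∈ TrSet (A \ B)) :
    minLabel c < minLabel T ↔ m ∈ B := by
  constructor
  · intro h
    by_contra hmB
    have h1 := minLabel_eq (m := m) (by simp [hm, hmB]) (fun z hz => hmin z (by simp at hz; exact hz.1)) hT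
    have h2 : m ≤ minLabel c := by
      rw [le_minLabel]; exact fun w hw => hmin w (hB ((mem_labels_of hc w).1 hw))
    omega
  · intro hmB
    have h1 := minLabel_eq hmB (fun z hz => hmin z (hB hz)) hc
    have h2 : m + 1 ≤ minLabel T := by
      rw [le_minLabel]; intro w hw
      have := (mem_labels_of hT w).1 hw
      simp only [Finset.mem_sdiff] at this
      have h3 := hmin w this.1
      have : m ≠ w := by rintro rfl; exact this.2 hmB
      omega
    omega

theorem P_rec (x y : R) {A : Finset ℕ} (hA : A.card ≠ 1) {m : ℕ} (hm : m ∈ A)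
    (hmin : ∀ z ∈ A, m ≤ z) :
    P x y A = ∑ B ∈ A.powerset with m ∉ B, (x + y) * P x y B * P x y (A \ B) := by
  have h1 : P x y A = ∑ B ∈ A.powerset, (if m ∈ B then x else y) * P x y B * P x y (A \ B) := by
    rw [P, sum_Tr A hA]
    refine Finset.sum_congr rfl fun B hB => ?_
    rw [P, P, mul_assoc, Finset.sum_mul_sum, Finset.mul_sum]
    refine Finset.sum_congr rfl fun c hc => ?_
    rw [Finset.mul_sum]
    refine Finset.sum_congr rfl fun T hT => ?_
    rw [impr_graft, propCount_graft]
    simp only [minLabel_lt_iff hm hmin (Finset.mem_powerset.1 hB) (mem_Tr.1 hc) (mem_Tr.1 hT)]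
    split_ifs <;> ring
  have h2 : ∑ B ∈ A.powerset with m ∈ B, x * P x y B * P x y (A \ B)
      = ∑ B ∈ A.powerset with m ∉ B, x * P x y B * P x y (A \ B) := by
    refine Finset.sum_nbij' (fun B => A \ B) (fun B => A \ B) ?_ ?_ ?_ ?_ ?_
    · intro B hB; simp at hB ⊢; tauto
    · intro B hB; simp at hB ⊢; tauto
    · intro B hB; simp at hB ⊢; exact hB.1
    · intro B hB; simp at hB ⊢; exact hB.1
    · intro B hB
      simp only [Finset.mem_filter, Finset.mem_powerset] at hB
      rw [Finset.sdiff_sdiff_eq_self hB.1]; ring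
  rw [h1, ← Finset.sum_filter_add_sum_filter_not _ (fun B => m ∈ B)]
  rw [Finset.sum_congr rfl (g := fun B => x * P x y B * P x y (A \ B)), h2,
    ← Finset.sum_add_distrib]
  · refine Finset.sum_congr rfl fun B hB => ?_
    rw [if_neg (Finset.mem_filter.1 hB).2]; ring
  · intro B hB
    rw [if_pos (Finset.mem_filter.1 hB).2]

theorem O_rec (x y t : R) {A : Finset ℕ} (hA : A.card ≠ 1) {m : ℕ} (hm : m ∈ A)
    (hmin : ∀ z ∈ A, m ≤ z) :
    O x y t m A = ∑ B ∈ A.powerset with m ∉ B, t * P x y B * O x y t m (A \ B) := by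
  rw [O, sum_Tr A hA, Finset.sum_filter]
  refine Finset.sum_congr rfl fun B hB => ?_
  have hBA := Finset.mem_powerset.1 hB
  by_cases hmB : m ∉ B
  · rw [if_pos hmB, P, O, mul_assoc, Finset.sum_mul_sum, Finset.mul_sum]
    refine Finset.sum_congr rfl fun c hc => ?_
    rw [Finset.mul_sum]
    refine Finset.sum_congr rfl fun T hT => ?_
    rw [impr_graft, propCount_graft, rootLabel_graft, rootDeg_graft]
    simp only [minLabel_lt_iff hm hmin hBA (mem_Tr.1 hc) (mem_Tr.1 hT), hmB, if_false]
    split_ifs with hr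
    · have := rootDeg_le_propCount T (by
        intro z hz
        rw [hr]
        have := (mem_labels_of (mem_Tr.1 hT) z).1 hz
        exact hmin z (Finset.mem_sdiff.1 this).1)
      rw [show 1 + propCount c + propCount T - (rootDeg T + 1)
        = propCount c + (propCount T - rootDeg T) by omega]
      ring
    · ring
  · rw [if_neg hmB]
    refine Finset.sum_eq_zero fun c hc => Finset.sum_eq_zero fun T hT => ?_
    rw [rootLabel_graft, if_neg]
    intro hr
    have := (mem_labels_of (mem_Tr.1 hT) _).1 (rootLabel_mem T)
    rw [hr] at this
    simp only [Finset.mem_sdiff] at this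
    tauto

theorem J_rec (s t : R) {A : Finset ℕ} (hA : A.card ≠ 1) {m : ℕ} (hm : m ∈ A)
    (hmin : ∀ z ∈ A, m ≤ z) :
    J s t A = ∑ B ∈ A.powerset with m ∉ B, t * J s s B * J s t (A \ B) := by
  classical
  rw [J, sum_Tr A hA, Finset.sum_filter]
  refine Finset.sum_congr rfl fun B hB => ?_
  have hBA := Finset.mem_powerset.1 hB
  have key : ∀ c ∈ Tr B, ∀ T ∈ Tr (A \ B), Increasing (graft c T) ↔
      (m ∉ B ∧ Increasing c ∧ Increasing T) := by
    intro c hc T hT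
    rw [mem_Tr] at hc hT
    rw [increasing_graft]
    have hrc := (mem_labels_of hc _).1 (rootLabel_mem c)
    have hrT := (mem_labels_of hT _).1 (rootLabel_mem T)
    rw [Finset.mem_sdiff] at hrT
    constructor
    · rintro ⟨h1, h2, h3⟩
      refine ⟨fun hmB => ?_, h1, h2⟩
      have h4 := h1.root_le m ((mem_labels_of hc m).2 hmB)
      have h5 := hmin _ hrT.1
      omega
    · rintro ⟨hmB, h1, h2⟩
      refine ⟨h1, h2, ?_⟩
      have h4 := h2.root_le m ((mem_labels_of hT m).2 (by simp [hm, hmB]))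
      have h5 := hmin _ (hBA hrc)
      have : m ≠ rootLabel c := by
        intro h; rw [← h] at hrc; exact hmB hrc
      omega
  by_cases hmB : m ∉ B
  · rw [if_pos hmB, J, J, mul_assoc, Finset.sum_mul_sum, Finset.mul_sum]
    refine Finset.sum_congr rfl fun c hc => ?_
    rw [Finset.mul_sum]
    refine Finset.sum_congr rfl fun T hT => ?_
    simp only [key c hc T hT, hmB, not_false_eq_true, true_and, rootDeg_graft]
    by_cases h1 : Increasing c <;> by_cases h2 : Increasing T <;> simp only [h1, h2, and_true,
      and_false, if_true, if_false, mul_zero, zero_mul, and_self]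
    have e1 := length_of (mem_Tr.1 hc)
    have e2 := length_of (mem_Tr.1 hT)
    have e3 := rootDeg_lt c
    have e4 := rootDeg_lt T
    have e5 := Finset.card_sdiff_add_card_eq_card hBA
    rw [show A.card - 1 - (rootDeg T + 1) = rootDeg c + (B.card - 1 - rootDeg c)
      + ((A \ B).card - 1 - rootDeg T) by omega]
    ring
  · rw [if_neg hmB]
    refine Finset.sum_eq_zero fun c hc => Finset.sum_eq_zero fun T hT => ?_
    rw [if_neg]
    rw [key c hc T hT]; tauto

theorem P_eq_J (x y : R) (A : Finset ℕ) : P x y A = J (x + y) (x + y) A := by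
  classical
  induction A using Finset.strongInduction with
  | H A ih =>
    rcases A.eq_empty_or_nonempty with rfl | hne
    · simp [P, J, Tr_empty]
    by_cases hA : A.card = 1
    · obtain ⟨a, rfl⟩ := Finset.card_eq_one.1 hA
      simp [P, J, Tr_singleton, increasing_leaf, impr, improperEdges, improperEdgesAux,
        propCount, properEdges, properEdgesAux, rootDeg, children]
    · have hm := A.min'_mem hne
      have hmin : ∀ z ∈ A, A.min' hne ≤ z := fun z hz => A.min'_le z hz
      rw [P_rec x y hA hm hmin, J_rec _ _ hA hm hmin]
      refine Finset.sum_congr rfl fun B hB => ?_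
      simp only [Finset.mem_filter, Finset.mem_powerset] at hB
      have hBA : B ⊂ A := lt_of_le_of_ne hB.1 (by rintro rfl; exact hB.2 hm)
      rcases B.eq_empty_or_nonempty with rfl | hBne
      · simp [P, J, Tr_empty]
      rw [ih B hBA, ih _ (Finset.sdiff_ssubset hB.1 hBne)]

theorem O_eq_J (x y t : R) (m : ℕ) (A : Finset ℕ) (hm : m ∈ A) (hmin : ∀ z ∈ A, m ≤ z) :
    O x y t m A = J (x + y) t A := by
  classical
  induction A using Finset.strongInduction with
  | H A ih =>
    by_cases hA : A.card = 1
    · obtain ⟨a, rfl⟩ := Finset.card_eq_one.1 hA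
      have : m = a := by simpa using hm
      simp [O, J, Tr_singleton, increasing_leaf, impr, improperEdges, improperEdgesAux,
        propCount, properEdges, properEdgesAux, rootDeg, children, rootLabel, this]
    · rw [O_rec x y t hA hm hmin, J_rec _ _ hA hm hmin]
      refine Finset.sum_congr rfl fun B hB => ?_
      simp only [Finset.mem_filter, Finset.mem_powerset] at hB
      rcases B.eq_empty_or_nonempty with rfl | hBne
      · simp [P, J, Tr_empty]
      rw [P_eq_J, ih _ (Finset.sdiff_ssubset hB.1 hBne) (by simp [hm, hB.2])
        (fun z hz => hmin z (Finset.mem_sdiff.1 hz).1)]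

end gf

theorem isLPT_iff (n : ℕ) (T : LTree) : IsLPT n T ↔ T ∈ Tr (Finset.Icc 1 (n + 1)) := by
  rw [mem_Tr, IsLPT, TrSet, Set.mem_ofPred_eq, ← Multiset.coe_eq_coe]
  rfl

end LTree

/-- `Oₙ(x,y,t) = Σ_{r=1}^{n} tʳ S_{n,r} (x+y)^{n-r}` for `n ≥ 1`, where
`Oₙ(x,y,t) = Σ_{T ∈ 𝒪ₙ} x^{impr T} y^{prop T - deg_T(1)} t^{deg_T(1)}` is the sum
over all labeled plane trees with `n` edges whose root is labeled `1`, as an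
identity in the polynomial ring `ℤ[x, y, t]` (with `x = X 0`, `y = X 1`, `t = X 2`). -/
theorem rootOnePlaneTree_improper_proper_polynomial (n : ℕ) (hn : 1 ≤ n) :
    (∑ᶠ T ∈ {T : LTree | LTree.IsLPT n T ∧ LTree.rootLabel T = 1},
        (X 0 : MvPolynomial (Fin 3) ℤ) ^ LTree.impr T
          * (X 1) ^ (LTree.propCount T - LTree.rootDeg T) * (X 2) ^ LTree.rootDeg T)
      = ∑ r ∈ Finset.Icc 1 n,
          (X 2 : MvPolynomial (Fin 3) ℤ) ^ r * (Snr n r : MvPolynomial (Fin 3) ℤ)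
            * (X 0 + X 1) ^ (n - r) := by
  classical
  have hL : (∑ᶠ T ∈ {T : LTree | LTree.IsLPT n T ∧ LTree.rootLabel T = 1},
        (X 0 : MvPolynomial (Fin 3) ℤ) ^ LTree.impr T
          * (X 1) ^ (LTree.propCount T - LTree.rootDeg T) * (X 2) ^ LTree.rootDeg T)
      = LTree.O (X 0) (X 1) (X 2) 1 (Finset.Icc 1 (n + 1)) := by
    rw [LTree.O, ← Finset.sum_filter, ← finsum_mem_coe_finset]
    have hs : {T : LTree | LTree.IsLPT n T ∧ LTree.rootLabel T = 1} =
        (((LTree.Tr (Finset.Icc 1 (n + 1))).filter fun T => LTree.rootLabel T = 1 :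
          Finset LTree) : Set LTree) := by
      ext T
      simp [LTree.isLPT_iff]
    rw [hs]
  have hS : ∀ r, Snr n r = ((LTree.Tr (Finset.Icc 1 (n + 1))).filter
      fun T => LTree.Increasing T ∧ LTree.rootDeg T = r).card := by
    intro r
    rw [Snr]
    apply Nat.subtype_card
    intro T
    simp [LTree.isLPT_iff]
  rw [hL, LTree.O_eq_J _ _ _ _ _ (by simp) (fun z hz => (Finset.mem_Icc.1 hz).1), LTree.J,
    ← Finset.sum_filter]
  have hmaps : ∀ T ∈ (LTree.Tr (Finset.Icc 1 (n + 1))).filter LTree.Increasing,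
      LTree.rootDeg T ∈ Finset.Icc 1 n := by
    intro T hT
    have hT := LTree.mem_Tr.1 (Finset.mem_filter.1 hT).1
    have h1 := LTree.length_of hT
    have h2 := LTree.rootDeg_lt T
    rw [Nat.card_Icc] at h1
    rw [Finset.mem_Icc]
    refine ⟨?_, by omega⟩
    rcases T with ⟨a, _ | ⟨c, cs⟩⟩
    · simp [LTree.labels, LTree.labelsList] at h1
      omega
    · simp [LTree.rootDeg, LTree.children]
  rw [← Finset.sum_fiberwise_of_maps_to hmaps]
  refine Finset.sum_congr rfl fun r _ => ?_
  rw [hS, Finset.filter_filter]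
  rw [Finset.sum_congr rfl (g := fun _ => (X 2 : MvPolynomial (Fin 3) ℤ) ^ r
    * (X 0 + X 1) ^ (n - r))]
  · rw [Finset.sum_const, nsmul_eq_mul]; ring
  · intro T hT
    rw [(Finset.mem_filter.1 hT).2.2]
    simp
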